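/- Let κ, ρ ∈ (0,1) and q ≥ 0. Let S, d ∈ ℝ with S ≠ 0 and |d| ≤ q, and set S⁺ = (1−κ)S − (κ+ρ+q)·sgn(S) + d, where sgn denotes the real sign function (sgn 0 = 0). Then S·(S⁺ − S) ≤ −κ·S² − (κ+ρ)·|S| < 0. -/

import Mathlib

/-- one-step reaching inequality (Eq. 60): for `κ, ρ ∈ (0,1)`, `q ≥ 0`,
`S ≠ 0`, `|d| ≤ q`, and `S⁺ = (1-κ)S - (κ+ρ+q)·sgn(S) + d`,
`S·(S⁺ - S) ≤ -κ S² - (κ+ρ)|S| < 0`. -/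
theorem stmt_9 (κ ρ q : ℝ) (hκ : κ ∈ Set.Ioo (0 : ℝ) 1) (hρ : ρ ∈ Set.Ioo (0 : ℝ) 1)
    (hq : 0 ≤ q) (S d : ℝ) (hS : S ≠ 0) (hd : |d| ≤ q)
    (Splus : ℝ) (hSplus : Splus = (1 - κ) * S - (κ + ρ + q) * Real.sign S + d) :
    S * (Splus - S) ≤ -κ * S ^ 2 - (κ + ρ) * |S| ∧
      -κ * S ^ 2 - (κ + ρ) * |S| < 0 := by
  obtain ⟨hκ0, _⟩ := hκ
  obtain ⟨hρ0, _⟩ := hρ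
  obtain ⟨hd1, hd2⟩ := abs_le.mp hd
  subst hSplus
  constructor
  · rcases lt_or_gt_of_ne hS with h | h
    · rw [Real.sign_of_neg h, abs_of_neg h]
      nlinarith [mul_nonneg (neg_pos.mpr h).le (by linarith : 0 ≤ q + d)]
    · rw [Real.sign_of_pos h, abs_of_pos h]
      nlinarith [mul_nonneg h.le (by linarith : 0 ≤ q - d)]
  · have h1 : 0 < |S| := abs_pos.mpr hS
    have h2 : 0 < κ * S ^ 2 := by positivity
    have h3 : 0 < (κ + ρ) * |S| := by positivity
    linarith
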